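/- The extra force contribution from the purely regularized (δ²) kernel terms satisfies: there exist constants C > 0 and ε₀ > 0, depending only on c_Γ and κ_max, such that for all 0 < ε < ε₀, 0 < δ < ε₀, every f ∈ C¹(ℝ/ℤ; ℝ³), and every s ∈ ℝ/ℤ, |F^δ(s) + ((δ²/ε²)/(1 + δ²/ε²)²) f(s)| ≤ C √(ε² + δ²) ‖f‖_{C¹}. -/

import Mathlib

open MeasureTheory

noncomputable section

local notation "⟪" x ", " y "⟫" => @inner ℝ _ _ x y

abbrev V3 : Type := EuclideanSpace ℝ (Fin 3)

/-- The `C⁰` (sup) norm of a function `ℝ/ℤ → ℝ³`. -/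
def C0norm (f : ℝ → V3) : ℝ := ⨆ s : ℝ, ‖f s‖

/-- The `C¹` norm of a function `ℝ/ℤ → ℝ³`. -/
def C1norm (f : ℝ → V3) : ℝ := C0norm f + C0norm (deriv f)

/-- The radial unit vector `e_ρ(s,θ) = cos θ e_{n1}(s) + sin θ e_{n2}(s)`. -/
def ePerp (en1 en2 : ℝ → V3) (s θ : ℝ) : V3 :=
  Real.cos θ • en1 s + Real.sin θ • en2 s

/-- `R(s, s̄, θ) = X(s) + ε e_ρ(s,θ) − X(s − s̄)`. -/
def Rvec (X en1 en2 : ℝ → V3) (ε s sb θ : ℝ) : V3 :=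
  X s + ε • ePerp en1 en2 s θ - X (s - sb)

/-- The slender-body geometry hypotheses: `X : ℝ/ℤ → ℝ³` is a `C²` closed curve
parameterized by arclength, non-self-intersecting with constant `cΓ`, with curvature
bounded by `κmax`, together with a `C¹` orthonormal frame `(X', en1, en2)`. -/
structure SlenderGeom (cΓ κmax : ℝ) (X en1 en2 : ℝ → V3) : Prop where
  smooth : ContDiff ℝ 2 X
  periodicX : ∀ s, X (s + 1) = X s
  arclength : ∀ s, ‖deriv X s‖ = 1
  no_self_intersect : ∀ s t : ℝ, |s - t| ≤ 1 / 2 → cΓ * |s - t| ≤ ‖X s - X t‖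
  curvature_max : ∀ s, ‖deriv (deriv X) s‖ ≤ κmax
  en1_smooth : ContDiff ℝ 1 en1
  en2_smooth : ContDiff ℝ 1 en2
  en1_periodic : ∀ s, en1 (s + 1) = en1 s
  en2_periodic : ∀ s, en2 (s + 1) = en2 s
  en1_unit : ∀ s, ‖en1 s‖ = 1
  en2_unit : ∀ s, ‖en2 s‖ = 1
  es_en1 : ∀ s, ⟪deriv X s, en1 s⟫ = 0
  es_en2 : ∀ s, ⟪deriv X s, en2 s⟫ = 0
  en1_en2 : ∀ s, ⟪en1 s, en2 s⟫ = 0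

/-- The singular Stokeslet `S(y) v = v/|y| + (y·v) y/|y|³`. -/
def stokeslet (y v : V3) : V3 := ‖y‖⁻¹ • v + (‖y‖ ^ 3)⁻¹ • ⟪y, v⟫ • y

/-- The singular doublet `D(y) v = v/|y|³ − 3 (y·v) y/|y|⁵`. -/
def doubletK (y v : V3) : V3 := (‖y‖ ^ 3)⁻¹ • v - (3 * (‖y‖ ^ 5)⁻¹) • ⟪y, v⟫ • y

/-- The regularized Stokeslet `S_δ(y) v`. -/
def stokesletReg (δ : ℝ) (y v : V3) : V3 :=
  ((‖y‖ ^ 2 + δ ^ 2) ^ ((1 : ℝ) / 2))⁻¹ • v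
    + ((‖y‖ ^ 2 + δ ^ 2) ^ ((3 : ℝ) / 2))⁻¹ • (⟪y, v⟫ • y + δ ^ 2 • v)

/-- The regularized doublet `D_δ(y) v`. -/
def doubletReg (δ : ℝ) (y v : V3) : V3 :=
  ((‖y‖ ^ 2 + δ ^ 2) ^ ((3 : ℝ) / 2))⁻¹ • v
    - (3 * ((‖y‖ ^ 2 + δ ^ 2) ^ ((5 : ℝ) / 2))⁻¹) • (⟪y, v⟫ • y + δ ^ 2 • v)

/-- The classical slender-body velocity `u^SB(x)` with doublet coefficient `ε²/2`. -/
def uSB (X f : ℝ → V3) (ε : ℝ) (x : V3) : V3 :=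
  (8 * Real.pi)⁻¹ • ∫ t in (0:ℝ)..1,
    (stokeslet (x - X t) (f t) + (ε ^ 2 / 2) • doubletK (x - X t) (f t))

/-- The regularized slender-body velocity with doublet coefficient `β`. -/
def uReg (X f : ℝ → V3) (β δ : ℝ) (x : V3) : V3 :=
  (8 * Real.pi)⁻¹ • ∫ t in (0:ℝ)..1,
    (stokesletReg δ (x - X t) (f t) + β • doubletReg δ (x - X t) (f t))

/-- The Keller–Rubinow classical centerline velocity `u^SB_C(X(s))`. -/
def uSBC (X f : ℝ → V3) (ε s : ℝ) : V3 :=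
  (8 * Real.pi)⁻¹ •
    ((f s - (3 : ℝ) • ⟪deriv X s, f s⟫ • deriv X s
        - (2 * Real.log (Real.pi * ε / 4)) • (f s + ⟪deriv X s, f s⟫ • deriv X s))
      + ∫ t in (0:ℝ)..1,
          ((‖X s - X t‖⁻¹ • f t
              + (‖X s - X t‖ ^ 3)⁻¹ • ⟪X s - X t, f t⟫ • (X s - X t))
            - |Real.sin (Real.pi * (s - t)) / Real.pi|⁻¹
                • (f s + ⟪deriv X s, f s⟫ • deriv X s)))

/-- The regularized pressure `p^δ(x)`. -/
def pReg (X f : ℝ → V3) (δ : ℝ) (x : V3) : ℝ :=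
  (4 * Real.pi)⁻¹ * ∫ t in (0:ℝ)..1,
    (⟪x - X t, f t⟫ * ((‖x - X t‖ ^ 2 + δ ^ 2) ^ ((3 : ℝ) / 2))⁻¹
      + 3 * δ ^ 2 * ⟪x - X t, f t⟫ * (2 * (‖x - X t‖ ^ 2 + δ ^ 2) ^ ((5 : ℝ) / 2))⁻¹)

/-- The symmetric strain tensor `E(u) = (∇u + (∇u)ᵀ)/2` applied to the vector `n`. -/
def strainApply (u : V3 → V3) (x n : V3) : V3 :=
  (2 : ℝ)⁻¹ • (fderiv ℝ u x n + gradient (fun y => ⟪u y, n⟫) x)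

/-- The surface Jacobian `J_ε(s,θ) = ε(1 − ε(κ₁ cos θ + κ₂ sin θ))`. -/
def Jfac (X en1 en2 : ℝ → V3) (ε s θ : ℝ) : ℝ :=
  ε * (1 - ε * (⟪deriv (deriv X) s, en1 s⟫ * Real.cos θ
      + ⟪deriv (deriv X) s, en2 s⟫ * Real.sin θ))

/-- The regularized surface force density
`f^δ(s) = ∫_0^{2π} (2 E(u^δ) n − p^δ n) J_ε dθ`, with `n = −e_ρ`. -/
def fReg (X en1 en2 f : ℝ → V3) (ε δ s : ℝ) : V3 :=
  ∫ θ in (0:ℝ)..(2 * Real.pi),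
    Jfac X en1 en2 ε s θ •
      ((2 : ℝ) • strainApply (uReg X f ((ε ^ 2 + δ ^ 2) / 2) δ)
          (X s + ε • ePerp en1 en2 s θ) (-ePerp en1 en2 s θ)
        - pReg X f δ (X s + ε • ePerp en1 en2 s θ) • (-ePerp en1 en2 s θ))

/-- The vector field `d_n^δ[f](x)`. -/
def dReg (X f : ℝ → V3) (δ : ℝ) (n : ℕ) (x : V3) : V3 :=
  (8 * Real.pi)⁻¹ • ∫ t in (0:ℝ)..1,
    (δ ^ 2 * ((‖x - X t‖ ^ 2 + δ ^ 2) ^ ((n : ℝ) / 2))⁻¹) • f t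

/-- The scalar field `d_5^δ[f·R](x)`. -/
def dRegP (X f : ℝ → V3) (δ : ℝ) (x : V3) : ℝ :=
  (8 * Real.pi)⁻¹ * ∫ t in (0:ℝ)..1,
    δ ^ 2 * ⟪x - X t, f t⟫ * ((‖x - X t‖ ^ 2 + δ ^ 2) ^ ((5 : ℝ) / 2))⁻¹

/-- The extra force contribution
`F^δ(s) = ∫_0^{2π} (2E(d₃^δ[f])n − 3(ε²+δ²)E(d₅^δ[f])n − 3 d₅^δ[f·R] n) J_ε dθ`. -/
def Fextra (X en1 en2 f : ℝ → V3) (ε δ s : ℝ) : V3 :=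
  ∫ θ in (0:ℝ)..(2 * Real.pi),
    Jfac X en1 en2 ε s θ •
      ((2 : ℝ) • strainApply (dReg X f δ 3) (X s + ε • ePerp en1 en2 s θ)
          (-ePerp en1 en2 s θ)
        - (3 * (ε ^ 2 + δ ^ 2)) • strainApply (dReg X f δ 5)
            (X s + ε • ePerp en1 en2 s θ) (-ePerp en1 en2 s θ)
        - (3 * dRegP X f δ (X s + ε • ePerp en1 en2 s θ)) • (-ePerp en1 en2 s θ))


/-- The inverse regularized distance `(|y|² + δ²)^{-1/2}`. -/
def invRad (δ : ℝ) (y : V3) : ℝ := (√(‖y‖ ^ 2 + δ ^ 2))⁻¹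

lemma continuous_invRad {δ : ℝ} (hδ : 0 < δ) : Continuous (invRad δ) := by
  unfold invRad
  refine Continuous.inv₀ (by fun_prop) fun y => ?_
  positivity

lemma invRad_pos {δ : ℝ} (hδ : 0 < δ) (y : V3) : 0 < invRad δ y := by
  unfold invRad
  positivity

lemma invRad_le {δ : ℝ} (hδ : 0 < δ) (y : V3) : invRad δ y ≤ δ⁻¹ := by
  unfold invRad
  gcongr
  apply Real.le_sqrt_of_sq_le
  nlinarith [sq_nonneg ‖y‖]

lemma invRad_mul_norm_le {δ : ℝ} (hδ : 0 < δ) (y : V3) : invRad δ y * ‖y‖ ≤ 1 := by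
  unfold invRad
  rw [inv_mul_le_iff₀ (by positivity), mul_one]
  apply Real.le_sqrt_of_sq_le
  nlinarith [sq_nonneg δ]

lemma inv_rpow_eq_invRad_pow (δ : ℝ) (y : V3) (n : ℕ) :
    ((‖y‖ ^ 2 + δ ^ 2) ^ ((n : ℝ) / 2))⁻¹ = invRad δ y ^ n := by
  rw [Real.rpow_div_two_eq_sqrt _ (by positivity), Real.rpow_natCast, invRad, inv_pow]

lemma hasFDerivAt_invRad {δ : ℝ} (hδ : 0 < δ) (y : V3) :
    HasFDerivAt (invRad δ) (-(invRad δ y ^ 3) • innerSL ℝ y) y := by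
  have h1 : HasFDerivAt (fun y : V3 => ‖y‖ ^ 2 + δ ^ 2) (2 • innerSL ℝ y) y :=
    (hasStrictFDerivAt_norm_sq y).hasFDerivAt.add_const _
  have h0 : ‖y‖ ^ 2 + δ ^ 2 ≠ 0 := by positivity
  have h2 := (hasDerivAt_inv (x := √(‖y‖ ^ 2 + δ ^ 2)) (by positivity)).comp_hasFDerivAt y
    (h1.sqrt h0)
  refine h2.congr_fderiv ?_
  ext v
  simp only [invRad, smul_apply, smul_eq_mul, nsmul_eq_mul]
  simp
  field_simp

lemma hasFDerivAt_dReg {X f : ℝ → V3} {δ : ℝ} (hX : Continuous X) (hf : Continuous f)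
    (hδ : 0 < δ) (n : ℕ) (x : V3) :
    HasFDerivAt (dReg X f δ (n + 1))
      ((8 * Real.pi)⁻¹ • ∫ t in (0 : ℝ)..1,
        (-((n + 1) * δ ^ 2 * invRad δ (x - X t) ^ (n + 3))) •
          (innerSL ℝ (x - X t)).smulRight (f t)) x := by
  have hu : ∀ x : V3, Continuous fun t => invRad δ (x - X t) := fun x =>
    (continuous_invRad hδ).comp (by fun_prop)
  have hL : Continuous fun t => (innerSL ℝ (x - X t)).smulRight (f t) := by
    have : Continuous fun p : (V3 →L[ℝ] ℝ) × V3 => p.1.smulRight p.2 := by fun_prop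
    exact this.comp (f := fun t => (innerSL ℝ (x - X t), f t)) (by fun_prop)
  have hdef : dReg X f δ (n + 1) = fun x => (8 * Real.pi)⁻¹ • ∫ t in (0 : ℝ)..1,
      (δ ^ 2 * invRad δ (x - X t) ^ (n + 1)) • f t := by
    funext y
    simp only [dReg, inv_rpow_eq_invRad_pow]
  rw [hdef]
  refine HasFDerivAt.fun_const_smul (c := (8 * Real.pi)⁻¹) ?_
  refine intervalIntegral.hasFDerivAt_integral_of_dominated_of_fderiv_le
    (F' := fun x t => (-((n + 1) * δ ^ 2 * invRad δ (x - X t) ^ (n + 3))) •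
          (innerSL ℝ (x - X t)).smulRight (f t))
    (bound := fun t => (n + 1) * δ ^ 2 * (δ⁻¹) ^ (n + 2) * ‖f t‖)
    (s := Set.univ) Filter.univ_mem ?_ ?_ ?_ ?_ ?_ ?_
  · refine Filter.Eventually.of_forall fun y => ?_
    have := hu y
    exact Continuous.aestronglyMeasurable (by fun_prop)
  · have := hu x
    exact Continuous.intervalIntegrable (by fun_prop) _ _
  · have := hu x
    exact Continuous.aestronglyMeasurable (by fun_prop)
  · refine Filter.Eventually.of_forall fun t _ y _ => ?_
    have h0 := invRad_pos hδ (y - X t)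
    rw [norm_smul, ContinuousLinearMap.norm_smulRight_apply, innerSL_apply_norm, norm_neg,
      Real.norm_eq_abs, abs_of_nonneg (by positivity)]
    calc (n + 1) * δ ^ 2 * invRad δ (y - X t) ^ (n + 3) * (‖y - X t‖ * ‖f t‖)
        = (n + 1) * δ ^ 2 * invRad δ (y - X t) ^ (n + 2) * ‖f t‖
            * (invRad δ (y - X t) * ‖y - X t‖) := by ring
      _ ≤ (n + 1) * δ ^ 2 * (δ⁻¹) ^ (n + 2) * ‖f t‖ * 1 := by
          gcongr
          · exact invRad_le hδ _
          · exact invRad_mul_norm_le hδ _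
      _ = _ := mul_one _
  · exact Continuous.intervalIntegrable (by fun_prop) _ _
  · refine Filter.Eventually.of_forall fun t _ y _ => ?_
    have h1 := ((hasFDerivAt_invRad hδ (y - X t)).comp y
      ((hasFDerivAt_id y).sub_const (X t))).pow (n + 1)
    have h2 := (h1.const_mul (δ ^ 2)).smul_const (f t)
    refine h2.congr_fderiv ?_
    ext1 v
    simp
    rw [smul_smul]
    congr 1
    ring

lemma strainApply_dReg {X f : ℝ → V3} {δ : ℝ} (hX : Continuous X) (hf : Continuous f)
    (hδ : 0 < δ) (n : ℕ) (x v : V3) :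
    strainApply (dReg X f δ (n + 1)) x v =
      (8 * Real.pi)⁻¹ • ∫ t in (0 : ℝ)..1,
        (-((n + 1) * δ ^ 2 / 2 * invRad δ (x - X t) ^ (n + 3))) •
          (⟪x - X t, v⟫ • f t + ⟪f t, v⟫ • (x - X t)) := by
  have hD := hasFDerivAt_dReg hX hf hδ n x
  have hu : Continuous fun t => invRad δ (x - X t) := (continuous_invRad hδ).comp (by fun_prop)
  have hL : Continuous fun t => (innerSL ℝ (x - X t)).smulRight (f t) := by
    have : Continuous fun p : (V3 →L[ℝ] ℝ) × V3 => p.1.smulRight p.2 := by fun_prop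
    exact this.comp (f := fun t => (innerSL ℝ (x - X t), f t)) (by fun_prop)
  have happ : ∀ z, fderiv ℝ (dReg X f δ (n + 1)) x z = (8 * Real.pi)⁻¹ • ∫ t in (0 : ℝ)..1,
      (-((n + 1) * δ ^ 2 * invRad δ (x - X t) ^ (n + 3))) • ⟪x - X t, z⟫ • f t := by
    intro z
    rw [hD.fderiv, smul_apply, ContinuousLinearMap.intervalIntegral_apply]
    · simp only [smul_apply, ContinuousLinearMap.smulRight_apply, innerSL_apply_apply]
    · exact Continuous.intervalIntegrable (by fun_prop) _ _
  have hgrad : gradient (fun y => ⟪dReg X f δ (n + 1) y, v⟫) x =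
      (8 * Real.pi)⁻¹ • ∫ t in (0 : ℝ)..1,
        (-((n + 1) * δ ^ 2 * invRad δ (x - X t) ^ (n + 3))) • ⟪f t, v⟫ • (x - X t) := by
    refine ext_inner_right ℝ fun z => ?_
    rw [inner_gradient_left]
    have h1 : HasFDerivAt (fun y => ⟪dReg X f δ (n + 1) y, v⟫)
        ((innerSL ℝ v).comp (fderiv ℝ (dReg X f δ (n + 1)) x)) x := by
      have := (innerSL ℝ v).hasFDerivAt.comp x hD.differentiableAt.hasFDerivAt
      refine this.congr_of_eventuallyEq (Filter.Eventually.of_forall fun y => ?_)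
      simp [real_inner_comm]
    rw [h1.fderiv, ContinuousLinearMap.comp_apply, happ, map_smul,
      ← ContinuousLinearMap.intervalIntegral_comp_comm, real_inner_smul_left,
      real_inner_comm, ← innerSL_apply_apply ℝ z, ← ContinuousLinearMap.intervalIntegral_comp_comm, smul_eq_mul]
    · congr 1
      refine intervalIntegral.integral_congr fun t _ => ?_
      simp only [innerSL_apply_apply, inner_smul_right]
      rw [real_inner_comm v, real_inner_comm z]
      ring
    · exact Continuous.intervalIntegrable (by fun_prop) _ _
    · exact Continuous.intervalIntegrable (by fun_prop) _ _
  rw [strainApply, happ, hgrad, ← smul_add, smul_comm, ← intervalIntegral.integral_add,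
    ← intervalIntegral.integral_smul]
  · congr 1
    refine intervalIntegral.integral_congr fun t _ => ?_
    rw [← smul_add, smul_smul]
    congr 1
    ring
  · exact Continuous.intervalIntegrable (by fun_prop) _ _
  · exact Continuous.intervalIntegrable (by fun_prop) _ _

/-- The combined integrand of the extra force density, for displacement `w`, inverse regularized
distance `u`, radial direction `e` and density value `g`. -/
def stressKernel (η u : ℝ) (e w g : V3) : V3 :=
  u ^ 5 • (⟪w, e⟫ • g + ⟪g, e⟫ • w + ⟪w, g⟫ • e)
    - (5 / 2 * η ^ 2 * u ^ 7) • (⟪w, e⟫ • g + ⟪g, e⟫ • w)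

lemma extra_stress_eq_integral {X f : ℝ → V3} {δ : ℝ} (hX : Continuous X) (hf : Continuous f)
    (hδ : 0 < δ) {ε η : ℝ} (hη : η ^ 2 = ε ^ 2 + δ ^ 2) (x e : V3) :
    (2 : ℝ) • strainApply (dReg X f δ 3) x (-e)
        - (3 * (ε ^ 2 + δ ^ 2)) • strainApply (dReg X f δ 5) x (-e)
        - (3 * dRegP X f δ x) • (-e) =
      (3 * δ ^ 2 / (8 * Real.pi)) •
        ∫ t in (0 : ℝ)..1, stressKernel η (invRad δ (x - X t)) e (x - X t) (f t) := by
  have hu : Continuous fun t => invRad δ (x - X t) := (continuous_invRad hδ).comp (by fun_prop)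
  have hP : dRegP X f δ x • e = (8 * Real.pi)⁻¹ • ∫ t in (0 : ℝ)..1,
      (δ ^ 2 * ⟪x - X t, f t⟫ * invRad δ (x - X t) ^ 5) • e := by
    rw [intervalIntegral.integral_smul_const, smul_smul, dRegP]
    congr 2
    refine intervalIntegral.integral_congr fun t _ => ?_
    rw [← inv_rpow_eq_invRad_pow]
    norm_num
  rw [show (3 * dRegP X f δ x) • (-e) = -((3 : ℝ) • dRegP X f δ x • e) by module, hP,
    strainApply_dReg hX hf hδ 2, strainApply_dReg hX hf hδ 4, ← hη]
  simp only [smul_smul, sub_neg_eq_add]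
  rw [mul_comm (2 : ℝ), mul_comm (3 * η ^ 2), mul_comm (3 : ℝ) (8 * Real.pi)⁻¹,
    show 3 * δ ^ 2 / (8 * Real.pi) = (8 * Real.pi)⁻¹ * (3 * δ ^ 2) by ring]
  simp only [mul_smul (8 * Real.pi)⁻¹]
  rw [← smul_sub, ← smul_add]
  congr 1
  rw [← intervalIntegral.integral_smul, ← intervalIntegral.integral_smul,
    ← intervalIntegral.integral_smul, ← intervalIntegral.integral_smul,
    ← intervalIntegral.integral_sub, ← intervalIntegral.integral_add]
  · refine intervalIntegral.integral_congr fun t _ => ?_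
    simp only [stressKernel, inner_neg_right]
    push_cast
    module
  all_goals exact Continuous.intervalIntegrable (by fun_prop) _ _

section KernelBounds

variable {V : Type*} [NormedAddCommGroup V] [InnerProductSpace ℝ V]

lemma norm_inner_smul_sub_le (a b c a' b' c' : V) :
    ‖⟪a, b⟫ • c - ⟪a', b'⟫ • c'‖
      ≤ ‖a - a'‖ * ‖b‖ * ‖c‖ + ‖a'‖ * ‖b - b'‖ * ‖c‖ + ‖a'‖ * ‖b'‖ * ‖c - c'‖ := by
  have h : ⟪a, b⟫ • c - ⟪a', b'⟫ • c' =
      ⟪a - a', b⟫ • c + ⟪a', b - b'⟫ • c + ⟪a', b'⟫ • (c - c') := by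
    rw [inner_sub_left, inner_sub_right]
    module
  rw [h]
  refine (norm_add₃_le).trans ?_
  simp only [norm_smul]
  gcongr <;> exact norm_inner_le_norm _ _

lemma norm_inner_smul_le (a b c : V) : ‖⟪a, b⟫ • c‖ ≤ ‖a‖ * ‖b‖ * ‖c‖ := by
  rw [norm_smul]
  gcongr
  exact norm_inner_le_norm _ _

end KernelBounds

lemma abs_pow_sub_pow_le_of_le {u u₀ m E : ℝ} (hm : 1 ≤ m) (hu₀ : 0 ≤ u₀) (hu : 0 ≤ u)
    (hum : u ≤ m * u₀) (hE : |u - u₀| ≤ E) (n : ℕ) :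
    |u ^ n - u₀ ^ n| ≤ E * n * (m * u₀) ^ (n - 1) := by
  refine (abs_pow_sub_pow_le u u₀ n).trans ?_
  have h : max |u| |u₀| ≤ m * u₀ := by
    rw [abs_of_nonneg hu, abs_of_nonneg hu₀]
    exact max_le hum (by nlinarith)
  have : 0 ≤ max |u| |u₀| := (abs_nonneg u).trans (le_max_left _ _)
  have : 0 ≤ E := (abs_nonneg _).trans hE
  gcongr

lemma norm_stressKernel_sub_le {η u u₀ m E κ N r : ℝ} {e w w₀ g g₀ : V3}
    (hm : 1 ≤ m) (hκ : 0 ≤ κ) (hN : 0 ≤ N) (hr : 0 < r) (hru : r * u₀ = 1) (hu : 0 ≤ u)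
    (hum : u ≤ m * u₀) (hE : |u - u₀| ≤ E) (hη : 0 ≤ η) (hηr : η ≤ r) (he : ‖e‖ = 1)
    (hw₀ : ‖w₀‖ ≤ r) (hw : ‖w - w₀‖ ≤ κ * r ^ 2) (hg : ‖g‖ ≤ N) (hg₀ : ‖g₀‖ ≤ N)
    (hgg : ‖g - g₀‖ ≤ N * r) :
    ‖stressKernel η u e w g - stressKernel η u₀ e w₀ g₀‖
      ≤ (3 * m ^ 5 * (κ + 1) + 15 * E * m ^ 4 + 5 * m ^ 7 * (κ + 1) + 35 * E * m ^ 6)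
        * N * u₀ ^ 3 := by
  have hu₀ : u₀ = r⁻¹ := by field_simp; linarith
  have hu₀0 : 0 < u₀ := by rw [hu₀]; positivity
  have hm0 : 0 < m := by linarith
  have hE0 : 0 ≤ E := (abs_nonneg _).trans hE
  have t1 : ‖⟪w, e⟫ • g - ⟪w₀, e⟫ • g₀‖ ≤ (κ + 1) * N * r ^ 2 := by
    refine (norm_inner_smul_sub_le _ _ _ _ _ _).trans ?_
    rw [sub_self, norm_zero, he]
    calc ‖w - w₀‖ * 1 * ‖g‖ + ‖w₀‖ * 0 * ‖g‖ + ‖w₀‖ * 1 * ‖g - g₀‖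
        ≤ (κ * r ^ 2) * 1 * N + ‖w₀‖ * 0 * ‖g‖ + r * 1 * (N * r) := by gcongr
      _ = _ := by ring
  have t2 : ‖⟪g, e⟫ • w - ⟪g₀, e⟫ • w₀‖ ≤ (κ + 1) * N * r ^ 2 := by
    rw [show ⟪g, e⟫ • w - ⟪g₀, e⟫ • w₀ = -(⟪g₀, e⟫ • w₀ - ⟪g, e⟫ • w) by abel, norm_neg]
    refine (norm_inner_smul_sub_le _ _ _ _ _ _).trans ?_
    rw [sub_self, norm_zero, he, norm_sub_rev g₀, norm_sub_rev w₀]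
    calc ‖g - g₀‖ * 1 * ‖w₀‖ + ‖g‖ * 0 * ‖w₀‖ + ‖g‖ * 1 * ‖w - w₀‖
        ≤ (N * r) * 1 * r + ‖g‖ * 0 * ‖w₀‖ + N * 1 * (κ * r ^ 2) := by gcongr
      _ = _ := by ring
  have t3 : ‖⟪w, g⟫ • e - ⟪w₀, g₀⟫ • e‖ ≤ (κ + 1) * N * r ^ 2 := by
    refine (norm_inner_smul_sub_le _ _ _ _ _ _).trans ?_
    rw [sub_self, norm_zero, he]
    calc ‖w - w₀‖ * ‖g‖ * 1 + ‖w₀‖ * ‖g - g₀‖ * 1 + ‖w₀‖ * ‖g₀‖ * 0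
        ≤ (κ * r ^ 2) * N * 1 + r * (N * r) * 1 + ‖w₀‖ * ‖g₀‖ * 0 := by gcongr
      _ = _ := by ring
  have s1 : ‖⟪w₀, e⟫ • g₀‖ ≤ r * N := by
    refine (norm_inner_smul_le _ _ _).trans ?_
    rw [he, mul_one]
    gcongr
  have s2 : ‖⟪g₀, e⟫ • w₀‖ ≤ r * N := by
    refine (norm_inner_smul_le _ _ _).trans ?_
    rw [he, mul_one, mul_comm]
    gcongr
  have s3 : ‖⟪w₀, g₀⟫ • e‖ ≤ r * N := by
    refine (norm_inner_smul_le _ _ _).trans ?_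
    rw [he, mul_one]
    gcongr
  have p5 : |u ^ 5| ≤ m ^ 5 * u₀ ^ 5 := by
    rw [abs_of_nonneg (by positivity), ← mul_pow]
    gcongr
  have p7 : |5 / 2 * η ^ 2 * u ^ 7| ≤ 5 / 2 * r ^ 2 * (m ^ 7 * u₀ ^ 7) := by
    rw [abs_of_nonneg (by positivity), ← mul_pow]
    gcongr
  have d5 := abs_pow_sub_pow_le_of_le hm hu₀0.le hu hum hE 5
  have d7 : |5 / 2 * η ^ 2 * (u ^ 7 - u₀ ^ 7)| ≤ 5 / 2 * r ^ 2 * (E * 7 * (m * u₀) ^ 6) := by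
    have := abs_pow_sub_pow_le_of_le hm hu₀0.le hu hum hE 7
    rw [abs_mul, abs_of_nonneg (by positivity)]
    push_cast at this
    gcongr
  have hdec : stressKernel η u e w g - stressKernel η u₀ e w₀ g₀ =
      u ^ 5 • ((⟪w, e⟫ • g - ⟪w₀, e⟫ • g₀) + (⟪g, e⟫ • w - ⟪g₀, e⟫ • w₀)
          + (⟪w, g⟫ • e - ⟪w₀, g₀⟫ • e))
        + (u ^ 5 - u₀ ^ 5) • (⟪w₀, e⟫ • g₀ + ⟪g₀, e⟫ • w₀ + ⟪w₀, g₀⟫ • e)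
        - ((5 / 2 * η ^ 2 * u ^ 7) •
            ((⟪w, e⟫ • g - ⟪w₀, e⟫ • g₀) + (⟪g, e⟫ • w - ⟪g₀, e⟫ • w₀))
          + (5 / 2 * η ^ 2 * (u ^ 7 - u₀ ^ 7)) • (⟪w₀, e⟫ • g₀ + ⟪g₀, e⟫ • w₀)) := by
    simp only [stressKernel]
    module
  rw [hdec]
  refine (norm_sub_le _ _).trans ?_
  refine (add_le_add (norm_add_le _ _) (norm_add_le _ _)).trans ?_
  simp only [norm_smul, Real.norm_eq_abs]
  calc _ ≤ m ^ 5 * u₀ ^ 5 * ((κ + 1) * N * r ^ 2 + (κ + 1) * N * r ^ 2 + (κ + 1) * N * r ^ 2)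
        + E * (5 : ℕ) * (m * u₀) ^ (5 - 1) * (r * N + r * N + r * N)
        + (5 / 2 * r ^ 2 * (m ^ 7 * u₀ ^ 7) * ((κ + 1) * N * r ^ 2 + (κ + 1) * N * r ^ 2)
          + 5 / 2 * r ^ 2 * (E * 7 * (m * u₀) ^ 6) * (r * N + r * N)) := by
        gcongr
        · exact norm_add₃_le.trans (by gcongr)
        · exact norm_add₃_le.trans (by gcongr)
        · exact (norm_add_le _ _).trans (by gcongr)
        · exact (norm_add_le _ _).trans (by gcongr)
    _ = _ := by
        rw [hu₀]
        push_cast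
        field_simp
        ring

section ModelIntegrals

/-- The inverse distance `(σ² + η²)^{-1/2}` of the straight model. -/
def modelInv (η σ : ℝ) : ℝ := (√(σ ^ 2 + η ^ 2))⁻¹

variable {η : ℝ}

lemma modelInv_sq_mul (hη : 0 < η) (σ : ℝ) : modelInv η σ ^ 2 * (σ ^ 2 + η ^ 2) = 1 := by
  rw [modelInv, inv_pow, Real.sq_sqrt (by positivity)]
  exact inv_mul_cancel₀ (by positivity)

lemma modelInv_pos (hη : 0 < η) (σ : ℝ) : 0 < modelInv η σ := by
  unfold modelInv
  positivity

lemma modelInv_neg (η σ : ℝ) : modelInv η (-σ) = modelInv η σ := by simp [modelInv]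

lemma hasDerivAt_modelInv (hη : 0 < η) (σ : ℝ) :
    HasDerivAt (modelInv η) (-(σ * modelInv η σ ^ 3)) σ := by
  have h1 : HasDerivAt (fun σ : ℝ => σ ^ 2 + η ^ 2) (2 * σ) σ := by
    simpa using (hasDerivAt_pow 2 σ).add_const (η ^ 2)
  have h2 := (h1.sqrt (by positivity)).inv (by positivity)
  refine h2.congr_deriv ?_
  simp only [modelInv]
  field_simp

@[fun_prop]
lemma continuous_modelInv (hη : 0 < η) : Continuous (modelInv η) :=
  continuous_iff_continuousAt.2 fun σ => (hasDerivAt_modelInv hη σ).continuousAt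

lemma hasDerivAt_mul_modelInv_pow (hη : 0 < η) (n : ℕ) (σ : ℝ) :
    HasDerivAt (fun σ => σ * modelInv η σ ^ (n + 1))
      ((n + 1) * η ^ 2 * modelInv η σ ^ (n + 3) - n * modelInv η σ ^ (n + 1)) σ := by
  have h := (hasDerivAt_id σ).mul ((hasDerivAt_modelInv hη σ).pow (n + 1))
  refine h.congr_deriv ?_
  have h1 := modelInv_sq_mul hη σ
  simp only [id, Nat.add_sub_cancel]
  push_cast
  rw [show σ * ((n + 1) * modelInv η σ ^ n * -(σ * modelInv η σ ^ 3)) =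
    -(n + 1) * (modelInv η σ ^ (n + 1) * (modelInv η σ ^ 2 * (σ ^ 2 + η ^ 2))
      - η ^ 2 * modelInv η σ ^ (n + 3)) by ring, h1]
  simp only [Pi.pow_apply]
  ring

lemma integral_modelInv_recurrence (hη : 0 < η) (n : ℕ) :
    (n + 1) * η ^ 2 * ∫ σ in (-(1 / 2) : ℝ)..1 / 2, modelInv η σ ^ (n + 3) =
      n * (∫ σ in (-(1 / 2) : ℝ)..1 / 2, modelInv η σ ^ (n + 1)) + modelInv η (1 / 2) ^ (n + 1) := by
  have hc := continuous_modelInv hη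
  have h := intervalIntegral.integral_eq_sub_of_hasDerivAt (a := -(1 / 2)) (b := 1 / 2)
    (fun σ _ => hasDerivAt_mul_modelInv_pow hη n σ)
    (Continuous.intervalIntegrable (by fun_prop) _ _)
  rw [intervalIntegral.integral_sub, intervalIntegral.integral_const_mul,
    intervalIntegral.integral_const_mul, modelInv_neg] at h
  · linarith
  all_goals exact Continuous.intervalIntegrable (by fun_prop) _ _

lemma integral_modelInv_odd (η : ℝ) (n : ℕ) :
    ∫ σ in (-(1 / 2) : ℝ)..1 / 2, σ * modelInv η σ ^ n = 0 := by
  have h := intervalIntegral.integral_comp_neg (a := -(1 / 2)) (b := 1 / 2)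
    (fun σ => σ * modelInv η σ ^ n)
  simp only [modelInv_neg, neg_neg, neg_mul, intervalIntegral.integral_neg] at h
  linarith

lemma modelInv_half_le (η : ℝ) : modelInv η (1 / 2) ≤ 2 := by
  rw [modelInv, inv_le_comm₀ (by positivity) (by norm_num)]
  apply Real.le_sqrt_of_sq_le
  nlinarith [sq_nonneg η]

lemma le_modelInv_half (η : ℝ) : 2 - 4 * η ^ 2 ≤ modelInv η (1 / 2) := by
  have h : √((1 / 2) ^ 2 + η ^ 2) ≤ 1 / 2 + η ^ 2 := by
    apply Real.sqrt_le_iff.2 ⟨by positivity, by nlinarith [sq_nonneg (η ^ 2)]⟩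
  calc 2 - 4 * η ^ 2 ≤ (1 / 2 + η ^ 2)⁻¹ := by
        rw [← one_div, le_div_iff₀ (by positivity)]
        nlinarith [sq_nonneg (η ^ 2)]
    _ ≤ _ := by
        unfold modelInv
        gcongr

lemma integral_modelInv_cube_le (hη : 0 < η) :
    ∫ σ in (-(1 / 2) : ℝ)..1 / 2, modelInv η σ ^ 3 ≤ 2 / η ^ 2 := by
  have h := integral_modelInv_recurrence hη 0
  norm_num at h
  rw [le_div_iff₀ (by positivity)]
  have := modelInv_half_le η
  norm_num at this ⊢
  linarith

lemma abs_integral_modelInv_five_sub_le (hη : 0 < η) :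
    |(∫ σ in (-(1 / 2) : ℝ)..1 / 2, modelInv η σ ^ 5) - 4 / (3 * η ^ 4)| ≤ 6 / η ^ 2 := by
  have h1 := integral_modelInv_recurrence hη 0
  have h2 := integral_modelInv_recurrence hη 2
  have hb0 := modelInv_pos hη (1 / 2)
  have hb1 := modelInv_half_le η
  have hb2 := le_modelInv_half η
  set b := modelInv η (1 / 2)
  set I₃ := ∫ σ in (-(1 / 2) : ℝ)..1 / 2, modelInv η σ ^ 3
  set I₅ := ∫ σ in (-(1 / 2) : ℝ)..1 / 2, modelInv η σ ^ 5
  have e1 : I₃ = b / η ^ 2 := by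
    field_simp
    simpa [I₃, mul_comm] using h1
  have e2 : I₅ = (2 * I₃ + b ^ 3) / (3 * η ^ 2) := by
    rw [eq_div_iff (by positivity)]
    push_cast at h2
    linarith
  have hb3 : b ^ 3 ≤ 8 := by
    calc b ^ 3 ≤ 2 ^ 3 := by gcongr
      _ = 8 := by norm_num
  have e3 : I₅ - 4 / (3 * η ^ 4) = (b ^ 3 * η ^ 2 - 2 * (2 - b)) / (3 * η ^ 4) := by
    rw [e2, e1]
    field_simp
    ring
  rw [e3, abs_div, abs_of_pos (show 0 < 3 * η ^ 4 by positivity),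
    div_le_div_iff₀ (by positivity) (by positivity)]
  have hη2 : 0 < η ^ 2 := by positivity
  have : |b ^ 3 * η ^ 2 - 2 * (2 - b)| ≤ 8 * η ^ 2 := by
    have : 0 ≤ b ^ 3 * η ^ 2 := by positivity
    rw [abs_le]
    constructor <;> nlinarith
  nlinarith

lemma integral_stressKernel_model (hη : 0 < η) (ε : ℝ) {a e : V3} (g : V3) (he : ‖e‖ = 1)
    (hae : ⟪a, e⟫ = 0) :
    ∫ σ in (-(1 / 2) : ℝ)..1 / 2, stressKernel η (modelInv η σ) e (ε • e + σ • a) g =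
      -(ε * ∫ σ in (-(1 / 2) : ℝ)..1 / 2, modelInv η σ ^ 5) • g
        - (ε * modelInv η (1 / 2) ^ 5 / 2) • (g + ⟪g, e⟫ • e) := by
  have hc := continuous_modelInv hη
  have hee : ⟪e, e⟫ = 1 := by rw [real_inner_self_eq_norm_sq, he, one_pow]
  have hK : ∀ σ, stressKernel η (modelInv η σ) e (ε • e + σ • a) g =
      modelInv η σ ^ 5 • (ε • (g + (2 * ⟪g, e⟫) • e))
        + (σ * modelInv η σ ^ 5) • (⟪g, e⟫ • a + ⟪a, g⟫ • e)
        - (modelInv η σ ^ 7 • ((5 / 2 * η ^ 2 * ε) • (g + ⟪g, e⟫ • e))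
          + (σ * modelInv η σ ^ 7) • ((5 / 2 * η ^ 2 * ⟪g, e⟫) • a)) := by
    intro σ
    simp only [stressKernel, inner_add_left, inner_smul_left, hee, hae, real_inner_comm g e,
      RCLike.conj_to_real]
    module
  simp only [hK]
  rw [intervalIntegral.integral_sub, intervalIntegral.integral_add, intervalIntegral.integral_add]
  · simp only [intervalIntegral.integral_smul_const, integral_modelInv_odd]
    have h := integral_modelInv_recurrence hη 4
    push_cast at h
    norm_num at h
    have h7 : η ^ 2 * ∫ σ in (-(1 / 2) : ℝ)..1 / 2, modelInv η σ ^ 7 =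
        (4 * (∫ σ in (-(1 / 2) : ℝ)..1 / 2, modelInv η σ ^ 5) + modelInv η (1 / 2) ^ 5) / 5 := by
      norm_num
      linarith
    rw [smul_smul (∫ σ in (-(1 / 2) : ℝ)..1 / 2, modelInv η σ ^ 7),
      show (∫ σ in (-(1 / 2) : ℝ)..1 / 2, modelInv η σ ^ 7) * (5 / 2 * η ^ 2 * ε) =
        5 / 2 * ε * (η ^ 2 * ∫ σ in (-(1 / 2) : ℝ)..1 / 2, modelInv η σ ^ 7) by ring, h7]
    module
  all_goals exact Continuous.intervalIntegrable (by fun_prop) _ _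

end ModelIntegrals

section Geometry

variable {cΓ κmax : ℝ} {X en1 en2 : ℝ → V3}

lemma SlenderGeom.curvature_nonneg (hG : SlenderGeom cΓ κmax X en1 en2) : 0 ≤ κmax :=
  (norm_nonneg _).trans (hG.curvature_max 0)

lemma SlenderGeom.hasDerivAt (hG : SlenderGeom cΓ κmax X en1 en2) (s : ℝ) :
    HasDerivAt X (deriv X s) s :=
  (hG.smooth.differentiable (by norm_num) s).hasDerivAt

lemma SlenderGeom.norm_ePerp (hG : SlenderGeom cΓ κmax X en1 en2) (s θ : ℝ) :
    ‖ePerp en1 en2 s θ‖ = 1 := by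
  have h : ‖ePerp en1 en2 s θ‖ ^ 2 = 1 := by
    rw [ePerp, norm_add_sq_real, norm_smul, norm_smul, hG.en1_unit, hG.en2_unit,
      inner_smul_left, inner_smul_right, hG.en1_en2]
    simp
  nlinarith [norm_nonneg (ePerp en1 en2 s θ)]

lemma SlenderGeom.inner_tangent_ePerp (hG : SlenderGeom cΓ κmax X en1 en2) (s θ : ℝ) :
    ⟪deriv X s, ePerp en1 en2 s θ⟫ = 0 := by
  simp [ePerp, inner_add_right, inner_smul_right, hG.es_en1, hG.es_en2]

lemma SlenderGeom.norm_chord_le (hG : SlenderGeom cΓ κmax X en1 en2) (s t : ℝ) :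
    ‖X s - X t‖ ≤ |s - t| := by
  have := convex_univ.norm_image_sub_le_of_norm_hasDerivWithin_le (f := X) (C := 1)
    (fun x _ => (hG.hasDerivAt x).hasDerivWithinAt) (fun x _ => (hG.arclength x).le)
    (Set.mem_univ t) (Set.mem_univ s)
  simpa using this

lemma SlenderGeom.norm_deriv_sub_le (hG : SlenderGeom cΓ κmax X en1 en2) (s t : ℝ) :
    ‖deriv X t - deriv X s‖ ≤ κmax * |t - s| := by
  have hd : Differentiable ℝ (deriv X) :=
    ((contDiff_succ_iff_deriv (n := 1)).1 hG.smooth).2.2.differentiable (by norm_num)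
  exact convex_univ.norm_image_sub_le_of_norm_hasDerivWithin_le
    (fun x _ => (hd x).hasDerivAt.hasDerivWithinAt) (fun x _ => hG.curvature_max x)
    (Set.mem_univ s) (Set.mem_univ t)

lemma SlenderGeom.norm_sub_sub_tangent_le (hG : SlenderGeom cΓ κmax X en1 en2) (s σ : ℝ) :
    ‖X s - X (s - σ) - σ • deriv X s‖ ≤ κmax * σ ^ 2 := by
  have hκ := hG.curvature_nonneg
  have h := (convex_uIcc s (s - σ)).norm_image_sub_le_of_norm_hasDerivWithin_le
    (f := fun t => X t - t • deriv X s) (f' := fun t => deriv X t - (1 : ℝ) • deriv X s)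
    (C := κmax * |σ|) (x := s - σ) (y := s)
    (fun x _ => ((hG.hasDerivAt x).sub ((hasDerivAt_id x).smul_const _)).hasDerivWithinAt)
    (fun x hx => by
      rw [one_smul]
      refine (hG.norm_deriv_sub_le s x).trans ?_
      refine mul_le_mul_of_nonneg_left ?_ hκ
      refine (Set.abs_sub_left_of_mem_uIcc hx).trans_eq ?_
      rw [sub_sub_cancel_left, abs_neg])
    Set.right_mem_uIcc Set.left_mem_uIcc
  rw [sub_sub_cancel, Real.norm_eq_abs, mul_assoc, abs_mul_abs_self, ← sq] at h
  refine le_of_eq_of_le (congrArg _ ?_) h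
  module

/-- Comparison of the squared regularized distance with that of the straight model. -/
lemma SlenderGeom.abs_dist_sq_sub_le (hG : SlenderGeom cΓ κmax X en1 en2) {ε : ℝ} (hε : 0 ≤ ε)
    (s σ θ : ℝ) :
    |‖X s + ε • ePerp en1 en2 s θ - X (s - σ)‖ ^ 2 - (‖X s - X (s - σ)‖ ^ 2 + ε ^ 2)|
      ≤ 2 * ε * (κmax * σ ^ 2) := by
  set e := ePerp en1 en2 s θ
  have he : ‖e‖ = 1 := hG.norm_ePerp s θ
  rw [show X s + ε • e - X (s - σ) = (X s - X (s - σ)) + ε • e by abel, norm_add_sq_real,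
    norm_smul, he, inner_smul_right, Real.norm_eq_abs, mul_one, sq_abs]
  rw [show ⟪X s - X (s - σ), e⟫ = ⟪X s - X (s - σ) - σ • deriv X s, e⟫ by
    rw [inner_sub_left _ (σ • deriv X s), inner_smul_left, hG.inner_tangent_ePerp, mul_zero,
      sub_zero]]
  have h : |⟪X s - X (s - σ) - σ • deriv X s, e⟫| ≤ κmax * σ ^ 2 := by
    refine (abs_real_inner_le_norm _ _).trans ?_
    rw [he, mul_one]
    exact hG.norm_sub_sub_tangent_le s σ
  rw [show ∀ a b c : ℝ, a + 2 * (ε * b) + c - (a + c) = 2 * ε * b by intros; ring, abs_mul,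
    abs_of_nonneg (by positivity)]
  gcongr

lemma SlenderGeom.abs_chord_sq_sub_le (hG : SlenderGeom cΓ κmax X en1 en2) (s σ : ℝ) :
    |‖X s - X (s - σ)‖ ^ 2 - σ ^ 2| ≤ 2 * κmax * |σ| ^ 3 := by
  have h1 : ‖X s - X (s - σ)‖ ≤ |σ| := by simpa using hG.norm_chord_le s (s - σ)
  have h2 : abs (‖X s - X (s - σ)‖ - |σ|) ≤ κmax * σ ^ 2 := by
    have := abs_norm_sub_norm_le (X s - X (s - σ)) (σ • deriv X s)
    rw [norm_smul, hG.arclength, mul_one, Real.norm_eq_abs] at this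
    exact this.trans (hG.norm_sub_sub_tangent_le s σ)
  have hκ := hG.curvature_nonneg
  rw [← sq_abs σ] at h2
  rw [← sq_abs σ, sq_sub_sq, abs_mul, abs_of_nonneg (by positivity)]
  calc (‖X s - X (s - σ)‖ + |σ|) * abs (‖X s - X (s - σ)‖ - |σ|)
      ≤ (|σ| + |σ|) * (κmax * |σ| ^ 2) := by gcongr
    _ = _ := by ring

lemma SlenderGeom.norm_model_sq (hG : SlenderGeom cΓ κmax X en1 en2) (ε s σ θ : ℝ) :
    ‖ε • ePerp en1 en2 s θ + σ • deriv X s‖ ^ 2 = ε ^ 2 + σ ^ 2 := by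
  rw [norm_add_sq_real, norm_smul, norm_smul, hG.norm_ePerp, hG.arclength, inner_smul_left,
    inner_smul_right, real_inner_comm, hG.inner_tangent_ePerp, Real.norm_eq_abs,
    Real.norm_eq_abs]
  simp only [mul_one, sq_abs, mul_zero, add_zero]

end Geometry

lemma abs_inv_sub_inv_le {ρ r m D : ℝ} (hr : 0 < r) (hρ : 0 < ρ) (hrm : r ≤ m * ρ)
    (hD : |ρ ^ 2 - r ^ 2| ≤ D * r ^ 3) : |ρ⁻¹ - r⁻¹| ≤ D * m := by
  have hD0 : 0 ≤ D := by
    by_contra h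
    have := (abs_nonneg _).trans hD
    have : 0 < r ^ 3 := by positivity
    nlinarith
  have h1 : ρ⁻¹ - r⁻¹ = -(ρ ^ 2 - r ^ 2) / ((ρ + r) * (ρ * r)) := by
    field_simp
    ring
  rw [h1, abs_div, abs_neg, abs_of_pos (show 0 < (ρ + r) * (ρ * r) by positivity),
    div_le_iff₀ (by positivity)]
  refine hD.trans ?_
  calc D * r ^ 3 = D * (r * r) * r := by ring
    _ ≤ D * (r * r) * (m * ρ) := by gcongr
    _ ≤ D * ((ρ + r) * r) * (m * ρ) := by
        have : 0 ≤ m * ρ := hr.le.trans hrm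
        gcongr
        linarith
    _ = _ := by ring

lemma regularized_radius_comparison {cΓ κ m ε δ η σ ℓ W : ℝ} (hm : 1 ≤ m) (hmΓ : 2 ≤ m * cΓ)
    (hcΓ : 0 < cΓ) (hκ : 0 ≤ κ) (hε : 0 < ε) (hεκ : 4 * (ε * κ) ≤ cΓ ^ 2) (hη0 : 0 < η)
    (hη : η ^ 2 = ε ^ 2 + δ ^ 2) (hlow : cΓ * |σ| ≤ ℓ)
    (hchord : |ℓ ^ 2 - σ ^ 2| ≤ 2 * κ * |σ| ^ 3)
    (hdist : |W ^ 2 - (ℓ ^ 2 + ε ^ 2)| ≤ 2 * ε * (κ * σ ^ 2)) :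
    √(σ ^ 2 + η ^ 2) ≤ m * √(W ^ 2 + δ ^ 2) ∧
      |√(W ^ 2 + δ ^ 2) ^ 2 - √(σ ^ 2 + η ^ 2) ^ 2| ≤ 4 * κ * √(σ ^ 2 + η ^ 2) ^ 3 := by
  set r := √(σ ^ 2 + η ^ 2)
  set ρ := √(W ^ 2 + δ ^ 2)
  have hr2 : r ^ 2 = σ ^ 2 + η ^ 2 := Real.sq_sqrt (by positivity)
  have hρ2 : ρ ^ 2 = W ^ 2 + δ ^ 2 := Real.sq_sqrt (by positivity)
  have hr0 : 0 < r := by positivity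
  have hσr : |σ| ≤ r := abs_le_of_sq_le_sq (by nlinarith) hr0.le
  have hεr : ε ≤ r := by nlinarith
  constructor
  · refine le_of_sq_le_sq ?_ (by positivity)
    have h1 : cΓ ^ 2 * σ ^ 2 ≤ ℓ ^ 2 := by
      rw [← sq_abs σ, ← mul_pow]
      gcongr
    have h2 : 2 ^ 2 ≤ m ^ 2 * cΓ ^ 2 := by
      rw [← mul_pow]
      gcongr
    have h3 : 4 * (ε * κ) * σ ^ 2 ≤ cΓ ^ 2 * σ ^ 2 := by gcongr
    have h4 : cΓ ^ 2 * σ ^ 2 / 2 + η ^ 2 ≤ ρ ^ 2 := by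
      have := (abs_le.1 hdist).1
      nlinarith
    have h5 : m ^ 2 * (cΓ ^ 2 * σ ^ 2 / 2 + η ^ 2) ≤ m ^ 2 * ρ ^ 2 := by gcongr
    have h6 : 1 ≤ m ^ 2 := one_le_pow₀ hm
    rw [mul_pow, hr2]
    nlinarith [sq_nonneg σ, sq_nonneg η, mul_le_mul_of_nonneg_right h2 (sq_nonneg σ),
      mul_le_mul_of_nonneg_right h6 (sq_nonneg η)]
  · have h1 : ρ ^ 2 - r ^ 2 = (W ^ 2 - (ℓ ^ 2 + ε ^ 2))
        + (ℓ ^ 2 - σ ^ 2) := by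
      rw [hρ2, hr2, hη]
      ring
    rw [h1]
    refine (abs_add_le _ _).trans ((add_le_add hdist hchord).trans ?_)
    rw [← sq_abs σ]
    calc 2 * ε * (κ * |σ| ^ 2) + 2 * κ * |σ| ^ 3
        ≤ 2 * r * (κ * r ^ 2) + 2 * κ * r ^ 3 := by gcongr
      _ = _ := by ring

/-- Constant in the pointwise comparison with the straight model. -/
def kernelConst (m κ : ℝ) : ℝ :=
  3 * m ^ 5 * (κ + 1) + 15 * (4 * κ * m) * m ^ 4 + 5 * m ^ 7 * (κ + 1) + 35 * (4 * κ * m) * m ^ 6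

lemma SlenderGeom.norm_stressKernel_sub_model_le {cΓ κmax : ℝ} {X en1 en2 : ℝ → V3}
    (hG : SlenderGeom cΓ κmax X en1 en2) {m ε δ η N : ℝ} (hm : 1 ≤ m) (hmΓ : 2 ≤ m * cΓ)
    (hε : 0 < ε) (hεκ : 4 * (ε * κmax) ≤ cΓ ^ 2) (hδ : 0 < δ) (hη0 : 0 < η)
    (hη : η ^ 2 = ε ^ 2 + δ ^ 2) {f : ℝ → V3} (hN : ∀ t, ‖f t‖ ≤ N)
    (hN' : ∀ s t, ‖f s - f t‖ ≤ N * |s - t|) (s θ σ : ℝ) (hσ : |σ| ≤ 1 / 2) :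
    ‖stressKernel η (invRad δ (X s + ε • ePerp en1 en2 s θ - X (s - σ))) (ePerp en1 en2 s θ)
        (X s + ε • ePerp en1 en2 s θ - X (s - σ)) (f (s - σ))
      - stressKernel η (modelInv η σ) (ePerp en1 en2 s θ)
        (ε • ePerp en1 en2 s θ + σ • deriv X s) (f s)‖
      ≤ kernelConst m κmax * N * modelInv η σ ^ 3 := by
  have hκ := hG.curvature_nonneg
  have hN0 : 0 ≤ N := (norm_nonneg _).trans (hN 0)
  have he := hG.norm_ePerp s θ
  have hdist := hG.abs_dist_sq_sub_le hε.le s σ θ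
  have hchord := hG.abs_chord_sq_sub_le s σ
  have hlow : cΓ * |σ| ≤ ‖X s - X (s - σ)‖ := by
    have := hG.no_self_intersect s (s - σ) (by simpa using hσ)
    simpa using this
  have htan := hG.norm_sub_sub_tangent_le s σ
  set e := ePerp en1 en2 s θ
  set w := X s + ε • e - X (s - σ) with hw
  have hcΓ : 0 < cΓ := by nlinarith
  obtain ⟨hrm, hD⟩ :=
    regularized_radius_comparison hm hmΓ hcΓ hκ hε hεκ hη0 hη hlow hchord hdist
  set r := √(σ ^ 2 + η ^ 2)
  set ρ := √(‖w‖ ^ 2 + δ ^ 2)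
  have hr2 : r ^ 2 = σ ^ 2 + η ^ 2 := Real.sq_sqrt (by positivity)
  have hr0 : 0 < r := by positivity
  have hρ0 : 0 < ρ := by positivity
  have hσr : |σ| ≤ r := abs_le_of_sq_le_sq (by nlinarith) hr0.le
  have hηr : η ≤ r := by nlinarith
  have hu : invRad δ w = ρ⁻¹ := rfl
  have hu₀ : modelInv η σ = r⁻¹ := rfl
  refine norm_stressKernel_sub_le hm hκ hN0 hr0 (by rw [hu₀]; field_simp) (invRad_pos hδ w).le
    ?_ (abs_inv_sub_inv_le hr0 hρ0 hrm hD) hη0.le hηr he ?_ ?_ (hN _) (hN _) ?_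
  · rw [hu, hu₀, ← div_eq_mul_inv, inv_le_comm₀ hρ0 (by positivity), inv_div]
    exact (div_le_iff₀ (by positivity)).2 (by linarith)
  · refine le_of_sq_le_sq ?_ hr0.le
    rw [hG.norm_model_sq, hr2, hη]
    nlinarith [sq_nonneg δ]
  · rw [hw, show X s + ε • e - X (s - σ) - (ε • e + σ • deriv X s) =
      X s - X (s - σ) - σ • deriv X s by abel]
    refine htan.trans ?_
    exact mul_le_mul_of_nonneg_left (by nlinarith) hκ
  · refine (hN' _ _).trans ?_
    rw [sub_sub_cancel_left, abs_neg]
    gcongr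

section SupNorm

lemma bddAbove_range_norm_of_periodic {f : ℝ → V3} (hf : Continuous f)
    (hp : ∀ s, f (s + 1) = f s) : BddAbove (Set.range fun s => ‖f s‖) := by
  have h := Function.Periodic.compact_of_continuous (f := fun s => ‖f s‖) (c := 1)
    (fun s => by simp [hp s]) one_ne_zero hf.norm
  exact h.bddAbove

lemma norm_le_C0norm {f : ℝ → V3} (hf : Continuous f) (hp : ∀ s, f (s + 1) = f s) (s : ℝ) :
    ‖f s‖ ≤ C0norm f :=
  le_ciSup (bddAbove_range_norm_of_periodic hf hp) s

lemma C0norm_nonneg (f : ℝ → V3) : 0 ≤ C0norm f := Real.iSup_nonneg fun _ => norm_nonneg _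

variable {f : ℝ → V3}

lemma norm_le_C1norm (hf : ContDiff ℝ 1 f) (hp : ∀ s, f (s + 1) = f s) (s : ℝ) :
    ‖f s‖ ≤ C1norm f :=
  (norm_le_C0norm hf.continuous hp s).trans (le_add_of_nonneg_right (C0norm_nonneg _))

lemma norm_sub_le_C1norm_mul (hf : ContDiff ℝ 1 f) (hp : ∀ s, f (s + 1) = f s) (s t : ℝ) :
    ‖f s - f t‖ ≤ C1norm f * |s - t| := by
  have hp' : ∀ s, deriv f (s + 1) = deriv f s := fun s => by
    rw [← deriv_comp_add_const]
    exact congrArg (fun g => deriv g s) (funext hp)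
  have hb : ∀ s, ‖deriv f s‖ ≤ C1norm f := fun s =>
    (norm_le_C0norm (hf.continuous_deriv le_rfl) hp' s).trans
      (le_add_of_nonneg_left (C0norm_nonneg _))
  exact convex_univ.norm_image_sub_le_of_norm_hasDerivWithin_le
    (fun x _ => (hf.differentiable one_ne_zero x).hasDerivAt.hasDerivWithinAt) (fun x _ => hb x)
    (Set.mem_univ t) (Set.mem_univ s)

end SupNorm

lemma continuous_stressKernel {α : Type*} [TopologicalSpace α] {η : ℝ} {u : α → ℝ} {e w g : α → V3}
    (hu : Continuous u) (he : Continuous e) (hw : Continuous w) (hg : Continuous g) :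
    Continuous fun t => stressKernel η (u t) (e t) (w t) (g t) := by
  unfold stressKernel
  fun_prop

section Assembly

variable {cΓ κmax : ℝ} {X en1 en2 : ℝ → V3}

lemma SlenderGeom.norm_integral_stressKernel_add_le
    (hG : SlenderGeom cΓ κmax X en1 en2) {m ε δ η N : ℝ} (hm : 1 ≤ m) (hmΓ : 2 ≤ m * cΓ)
    (hε : 0 < ε) (hε1 : ε ≤ 1) (hεκ : 4 * (ε * κmax) ≤ cΓ ^ 2) (hδ : 0 < δ) (hδ1 : δ ≤ 1)
    (hη0 : 0 < η) (hη : η ^ 2 = ε ^ 2 + δ ^ 2) {f : ℝ → V3} (hf : Continuous f)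
    (hp : ∀ s, f (s + 1) = f s) (hN : ∀ t, ‖f t‖ ≤ N)
    (hN' : ∀ s t, ‖f s - f t‖ ≤ N * |s - t|) (s θ : ℝ) :
    ‖(∫ t in (0 : ℝ)..1, stressKernel η (invRad δ (X s + ε • ePerp en1 en2 s θ - X t))
        (ePerp en1 en2 s θ) (X s + ε • ePerp en1 en2 s θ - X t) (f t))
      + (4 * ε / (3 * η ^ 4)) • f s‖ ≤ (2 * kernelConst m κmax + 70) * N / η ^ 2 := by
  have hN0 : 0 ≤ N := (norm_nonneg _).trans (hN 0)
  have hκ := hG.curvature_nonneg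
  have hC : 0 ≤ kernelConst m κmax := by unfold kernelConst; positivity
  have he := hG.norm_ePerp s θ
  have hmodel := integral_stressKernel_model hη0 ε (f s) he (hG.inner_tangent_ePerp s θ)
  have hpt := hG.norm_stressKernel_sub_model_le hm hmΓ hε hεκ hδ hη0 hη hN hN' s θ
  set e := ePerp en1 en2 s θ
  have hXc : Continuous X := hG.smooth.continuous
  have hc := continuous_modelInv hη0
  set K : ℝ → V3 := fun t => stressKernel η (invRad δ (X s + ε • e - X t)) e
    (X s + ε • e - X t) (f t) with hK
  have hKc : Continuous K :=
    continuous_stressKernel ((continuous_invRad hδ).comp (by fun_prop)) (by fun_prop)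
      (by fun_prop) hf
  have hKp : Function.Periodic K 1 := fun t => by simp only [hK, hG.periodicX, hp]
  have hshift : ∫ t in (0 : ℝ)..1, K t = ∫ σ in (-(1 / 2) : ℝ)..1 / 2, K (s - σ) := by
    rw [intervalIntegral.integral_comp_sub_left]
    have := hKp.intervalIntegral_add_eq 0 (s - 1 / 2)
    rw [zero_add] at this
    rw [this]
    congr 1
    ring
  set M : ℝ → V3 := fun σ => stressKernel η (modelInv η σ) e (ε • e + σ • deriv X s) (f s) with hM
  have hMc : Continuous M :=
    continuous_stressKernel hc (by fun_prop) (by fun_prop) (by fun_prop)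
  have hdiff : ‖∫ σ in (-(1 / 2) : ℝ)..1 / 2, (K (s - σ) - M σ)‖
      ≤ kernelConst m κmax * N * (2 / η ^ 2) := by
    refine (intervalIntegral.norm_integral_le_of_norm_le (by norm_num)
      (Filter.Eventually.of_forall fun σ hσ => hpt σ ?_)
      (Continuous.intervalIntegrable (by fun_prop) _ _)).trans ?_
    · exact abs_le.2 ⟨hσ.1.le, hσ.2⟩
    · rw [intervalIntegral.integral_const_mul]
      gcongr
      exact integral_modelInv_cube_le hη0
  rw [intervalIntegral.integral_sub (Continuous.intervalIntegrable (by fun_prop) _ _)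
    (hMc.intervalIntegrable _ _), hmodel, ← hshift] at hdiff
  have hI := abs_integral_modelInv_five_sub_le hη0
  set I₅ := ∫ σ in (-(1 / 2) : ℝ)..1 / 2, modelInv η σ ^ 5
  set b := modelInv η (1 / 2)
  have hb0 : 0 < b := modelInv_pos hη0 _
  have hb : b ^ 5 ≤ 32 := by
    calc b ^ 5 ≤ 2 ^ 5 := by
          gcongr
          exact modelInv_half_le η
      _ = 32 := by norm_num
  have hbη : ε * b ^ 5 ≤ 64 / η ^ 2 := by
    rw [le_div_iff₀ (by positivity)]
    have : η ^ 2 ≤ 2 := by nlinarith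
    calc ε * b ^ 5 * η ^ 2 ≤ 1 * 32 * 2 := by gcongr
      _ = 64 := by norm_num
  have hdec : (∫ t in (0 : ℝ)..1, K t) + (4 * ε / (3 * η ^ 4)) • f s =
      ((∫ t in (0 : ℝ)..1, K t) - (-(ε * I₅) • f s - (ε * b ^ 5 / 2) • (f s + ⟪f s, e⟫ • e)))
        - (ε * (I₅ - 4 / (3 * η ^ 4))) • f s
        - (ε * b ^ 5 / 2) • (f s + ⟪f s, e⟫ • e) := by
    module
  have h2 : ‖(ε * (I₅ - 4 / (3 * η ^ 4))) • f s‖ ≤ 6 / η ^ 2 * N := by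
    rw [norm_smul, Real.norm_eq_abs, abs_mul, abs_of_pos hε]
    calc ε * |I₅ - 4 / (3 * η ^ 4)| * ‖f s‖ ≤ 1 * (6 / η ^ 2) * N := by
          gcongr
          exact hN s
      _ = _ := by ring
  have h3 : ‖(ε * b ^ 5 / 2) • (f s + ⟪f s, e⟫ • e)‖ ≤ 64 / η ^ 2 * N := by
    have h4 : ‖f s + ⟪f s, e⟫ • e‖ ≤ 2 * N := by
      refine (norm_add_le _ _).trans ?_
      have := norm_inner_smul_le (f s) e e
      rw [he, mul_one, mul_one] at this
      linarith [hN s]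
    rw [norm_smul, Real.norm_eq_abs, abs_of_pos (by positivity)]
    calc ε * b ^ 5 / 2 * ‖f s + ⟪f s, e⟫ • e‖ ≤ 64 / η ^ 2 / 2 * (2 * N) := by gcongr
      _ = _ := by ring
  rw [hdec]
  refine (norm_sub_le _ _).trans ((add_le_add ((norm_sub_le _ _).trans
    (add_le_add hdiff h2)) h3).trans_eq ?_)
  ring

/-- The curvature factor in the surface Jacobian. -/
lemma SlenderGeom.exists_Jfac_eq (hG : SlenderGeom cΓ κmax X en1 en2) (ε s θ : ℝ) :
    ∃ k : ℝ, |k| ≤ κmax ∧ Jfac X en1 en2 ε s θ = ε * (1 - ε * k) := by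
  refine ⟨⟪deriv (deriv X) s, ePerp en1 en2 s θ⟫, ?_, ?_⟩
  · refine (abs_real_inner_le_norm _ _).trans ?_
    rw [hG.norm_ePerp, mul_one]
    exact hG.curvature_max s
  · simp only [Jfac, ePerp, inner_add_right, inner_smul_right]
    ring

lemma SlenderGeom.norm_extra_density_add_le
    (hG : SlenderGeom cΓ κmax X en1 en2) {m ε δ η N : ℝ} (hm : 1 ≤ m) (hmΓ : 2 ≤ m * cΓ)
    (hε : 0 < ε) (hε1 : ε ≤ 1) (hεκ : 4 * (ε * κmax) ≤ cΓ ^ 2) (hδ : 0 < δ) (hδ1 : δ ≤ 1)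
    (hη0 : 0 < η) (hη : η ^ 2 = ε ^ 2 + δ ^ 2) {f : ℝ → V3} (hf : Continuous f)
    (hp : ∀ s, f (s + 1) = f s) (hN : ∀ t, ‖f t‖ ≤ N)
    (hN' : ∀ s t, ‖f s - f t‖ ≤ N * |s - t|) (s θ : ℝ) :
    ‖Jfac X en1 en2 ε s θ • ((3 * δ ^ 2 / (8 * Real.pi)) •
        ∫ t in (0 : ℝ)..1, stressKernel η (invRad δ (X s + ε • ePerp en1 en2 s θ - X t))
          (ePerp en1 en2 s θ) (X s + ε • ePerp en1 en2 s θ - X t) (f t))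
      + (δ ^ 2 * ε ^ 2 / (2 * Real.pi * η ^ 4)) • f s‖
      ≤ ((1 + κmax) * (2 * kernelConst m κmax + 70) + κmax) * N * η := by
  have hbound := hG.norm_integral_stressKernel_add_le hm hmΓ hε hε1 hεκ hδ hδ1 hη0 hη hf hp hN hN' s θ
  obtain ⟨k, hk, hJ⟩ := hG.exists_Jfac_eq ε s θ
  have hκ := hG.curvature_nonneg
  have hN0 : 0 ≤ N := (norm_nonneg _).trans (hN 0)
  have hC : 0 ≤ kernelConst m κmax := by unfold kernelConst; positivity
  set C := 2 * kernelConst m κmax + 70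
  have hC0 : 0 ≤ C := by positivity
  set I := ∫ t in (0 : ℝ)..1, stressKernel η (invRad δ (X s + ε • ePerp en1 en2 s θ - X t))
          (ePerp en1 en2 s θ) (X s + ε • ePerp en1 en2 s θ - X t) (f t)
  have hπ := Real.pi_gt_three
  have hεη : ε ≤ η := by nlinarith
  have hδη : δ ^ 2 ≤ η ^ 2 := by nlinarith
  rw [hJ]
  have hdec : (ε * (1 - ε * k)) • ((3 * δ ^ 2 / (8 * Real.pi)) • I)
        + (δ ^ 2 * ε ^ 2 / (2 * Real.pi * η ^ 4)) • f s =
      (ε * (1 - ε * k) * (3 * δ ^ 2 / (8 * Real.pi))) • (I + (4 * ε / (3 * η ^ 4)) • f s)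
        + (ε * k * (δ ^ 2 * ε ^ 2 / (2 * Real.pi * η ^ 4))) • f s := by
    have : δ ^ 2 * ε ^ 2 / (2 * Real.pi * η ^ 4) =
        ε * (3 * δ ^ 2 / (8 * Real.pi)) * (4 * ε / (3 * η ^ 4)) := by
      field_simp
      ring
    rw [this]
    module
  rw [hdec]
  have a1 : |ε * (1 - ε * k) * (3 * δ ^ 2 / (8 * Real.pi))| ≤ η * (1 + κmax) * η ^ 2 := by
    rw [abs_mul, abs_mul, abs_of_pos hε, abs_of_pos (show 0 < 3 * δ ^ 2 / (8 * Real.pi) by positivity)]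
    gcongr
    · refine (abs_sub _ _).trans ?_
      rw [abs_one, abs_mul, abs_of_pos hε]
      nlinarith [abs_nonneg k]
    · rw [div_le_iff₀ (by positivity)]
      nlinarith [sq_nonneg η, sq_nonneg δ]
  have a2 : |ε * k * (δ ^ 2 * ε ^ 2 / (2 * Real.pi * η ^ 4))| ≤ η * κmax * 1 := by
    rw [abs_mul, abs_mul, abs_of_pos hε,
      abs_of_pos (show 0 < δ ^ 2 * ε ^ 2 / (2 * Real.pi * η ^ 4) by positivity)]
    gcongr
    rw [div_le_one (by positivity)]
    calc δ ^ 2 * ε ^ 2 ≤ η ^ 2 * η ^ 2 := by gcongr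
      _ = 1 * η ^ 4 := by ring
      _ ≤ 2 * Real.pi * η ^ 4 := by
          gcongr
          linarith
  refine (norm_add_le _ _).trans ?_
  rw [norm_smul, norm_smul, Real.norm_eq_abs, Real.norm_eq_abs]
  calc _ ≤ η * (1 + κmax) * η ^ 2 * (C * N / η ^ 2) + η * κmax * 1 * N := by
        gcongr
        exact hN s
    _ = _ := by field_simp

end Assembly

/-- The extra force contribution `F^δ` from the purely regularized (`δ²`)
kernel terms satisfies `|F^δ(s) + ((δ²/ε²)/(1+δ²/ε²)²) f(s)| ≤ C √(ε²+δ²) ‖f‖_{C¹}`. -/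
theorem extra_force_contribution (cΓ κmax : ℝ) (hcΓ : 0 < cΓ) :
    ∃ C > 0, ∃ ε₀ > 0,
      ∀ X en1 en2 : ℝ → V3, SlenderGeom cΓ κmax X en1 en2 →
      ∀ ε δ : ℝ, 0 < ε → ε < ε₀ → 0 < δ → δ < ε₀ →
      ∀ f : ℝ → V3, ContDiff ℝ 1 f → (∀ s, f (s + 1) = f s) →
      ∀ s : ℝ,
        ‖Fextra X en1 en2 f ε δ s
            + ((δ ^ 2 / ε ^ 2) / (1 + δ ^ 2 / ε ^ 2) ^ 2) • f s‖
          ≤ C * Real.sqrt (ε ^ 2 + δ ^ 2) * C1norm f := by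
  set m := 2 / cΓ + 1
  have hm : 1 ≤ m := le_add_of_nonneg_left (by positivity)
  have hmΓ : 2 ≤ m * cΓ := by
    have : 2 / cΓ * cΓ = 2 := div_mul_cancel₀ _ hcΓ.ne'
    nlinarith
  set A := (1 + |κmax|) * (2 * kernelConst m |κmax| + 70) + |κmax|
  have hC : 0 ≤ kernelConst m |κmax| := by unfold kernelConst; positivity
  have hA : 0 < A := by positivity
  refine ⟨A * (2 * Real.pi), by positivity, min 1 (cΓ ^ 2 / (4 * (|κmax| + 1))), by positivity, ?_⟩
  intro X en1 en2 hG ε δ hε hε₀ hδ hδ₀ f hf hp s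
  have hκ : |κmax| = κmax := abs_of_nonneg hG.curvature_nonneg
  have hκ0 := hG.curvature_nonneg
  simp only [A, hκ] at *
  have hε1 := (lt_min_iff.1 hε₀).1.le
  have hδ1 := (lt_min_iff.1 hδ₀).1.le
  have hεκ : 4 * (ε * κmax) ≤ cΓ ^ 2 := by
    have := (lt_div_iff₀ (by positivity)).1 (lt_min_iff.1 hε₀).2
    nlinarith
  set η := √(ε ^ 2 + δ ^ 2)
  have hη0 : 0 < η := by positivity
  have hη : η ^ 2 = ε ^ 2 + δ ^ 2 := Real.sq_sqrt (by positivity)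
  have hXc : Continuous X := hG.smooth.continuous
  have hfc := hf.continuous
  have hec : Continuous fun θ => ePerp en1 en2 s θ := by unfold ePerp; fun_prop
  have hF : Continuous fun θ => Jfac X en1 en2 ε s θ • ((3 * δ ^ 2 / (8 * Real.pi)) •
      ∫ t in (0 : ℝ)..1, stressKernel η (invRad δ (X s + ε • ePerp en1 en2 s θ - X t))
          (ePerp en1 en2 s θ) (X s + ε • ePerp en1 en2 s θ - X t) (f t)) := by
    have hJ : Continuous fun θ => Jfac X en1 en2 ε s θ := by unfold Jfac; fun_prop
    have hI : Continuous fun θ => ∫ t in (0 : ℝ)..1,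
        stressKernel η (invRad δ (X s + ε • ePerp en1 en2 s θ - X t))
          (ePerp en1 en2 s θ) (X s + ε • ePerp en1 en2 s θ - X t) (f t) := by
      refine intervalIntegral.continuous_parametric_intervalIntegral_of_continuous' ?_ _ _
      exact continuous_stressKernel ((continuous_invRad hδ).comp (by fun_prop)) (by fun_prop)
        (by fun_prop) (by fun_prop)
    fun_prop
  have hconst : ((δ ^ 2 / ε ^ 2) / (1 + δ ^ 2 / ε ^ 2) ^ 2) • f s =
      ∫ _ in (0 : ℝ)..(2 * Real.pi), (δ ^ 2 * ε ^ 2 / (2 * Real.pi * η ^ 4)) • f s := by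
    rw [intervalIntegral.integral_const, smul_smul]
    congr 1
    rw [show η ^ 4 = (η ^ 2) ^ 2 by ring, hη]
    field_simp
    ring
  rw [Fextra, hconst]
  simp only [extra_stress_eq_integral hXc hfc hδ hη]
  rw [← intervalIntegral.integral_add (hF.intervalIntegrable _ _)
    (continuous_const.intervalIntegrable _ _)]
  refine (intervalIntegral.norm_integral_le_of_norm_le_const fun θ _ =>
    hG.norm_extra_density_add_le hm hmΓ hε hε1 hεκ hδ hδ1 hη0 hη hfc hp
      (norm_le_C1norm hf hp) (norm_sub_le_C1norm_mul hf hp) s θ).trans_eq ?_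
  rw [sub_zero, abs_of_pos (by positivity)]
  ring
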